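/- arXiv:1911.07212 — 2 statements merged into one kernel-verified Lean document; each statement's English description precedes it below -/
import Mathlib

section
/- The GF(4)-linear span in GF(4)^10 of the six vectors r1=(1,0,0,0,0,0,ω,0,ω,ω̄), r3=(0,1,0,0,0,0,ω̄,1,1,1), r5=(0,0,1,0,0,0,1,ω,ω̄,0), r7=(0,0,0,1,0,0,0,1,ω,ω̄), r9=(0,0,0,0,1,0,ω̄,ω̄,0,1), r11=(0,0,0,0,0,1,1,ω,1,1) is a linear [10,6,4] code over GF(4): it has GF(4)-dimension 6, every nonzero element has Hamming weight at least 4, and some element has Hamming weight exactly 4. -/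
open Matrix
open scoped Classical

noncomputable section

abbrev F4 := GaloisField 2 2
abbrev F2 := ZMod 2

/-- Hamming weight: number of nonzero coordinates. -/
def wt {n : ℕ} {α : Type*} [Zero α] (v : Fin n → α) : ℕ :=
  Nat.card {i : Fin n // v i ≠ 0}

def r1 (ω : F4) : Fin 10 → F4 := ![1, 0, 0, 0, 0, 0, ω, 0, ω, ω + 1]
def r2 (ω : F4) : Fin 10 → F4 := ![ω, 0, 0, 0, 0, 0, ω + 1, 0, ω + 1, 1]
def r3 (ω : F4) : Fin 10 → F4 := ![0, 1, 0, 0, 0, 0, ω + 1, 1, 1, 1]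
def r4 (ω : F4) : Fin 10 → F4 := ![0, ω, 0, 0, 0, 0, 1, ω, ω, ω]
def r5 (ω : F4) : Fin 10 → F4 := ![0, 0, 1, 0, 0, 0, 1, ω, ω + 1, 0]
def r6 (ω : F4) : Fin 10 → F4 := ![0, 0, ω, 0, 0, 0, ω, ω + 1, 1, 0]
def r7 (ω : F4) : Fin 10 → F4 := ![0, 0, 0, 1, 0, 0, 0, 1, ω, ω + 1]
def r8 (ω : F4) : Fin 10 → F4 := ![0, 0, 0, ω, 0, 0, 0, ω, ω + 1, 1]
def r9 (ω : F4) : Fin 10 → F4 := ![0, 0, 0, 0, 1, 0, ω + 1, ω + 1, 0, 1]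
def r10 (ω : F4) : Fin 10 → F4 := ![0, 0, 0, 0, ω, 0, 1, 1, 0, ω]
def r11 (ω : F4) : Fin 10 → F4 := ![0, 0, 0, 0, 0, 1, 1, ω, 1, 1]
def r12 (ω : F4) : Fin 10 → F4 := ![0, 0, 0, 0, 0, ω, ω, ω + 1, ω, ω]

/-- The GF(4)-linear span of r1, r3, r5, r7, r9, r11 in GF(4)¹⁰. -/
def D10 (ω : F4) : Submodule F4 (Fin 10 → F4) :=
  Submodule.span F4 (Set.range ![r1 ω, r3 ω, r5 ω, r7 ω, r9 ω, r11 ω])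

/-- Elements of GF(4) as coordinate pairs in the basis `1, ω`. -/
def ofBits (ω : F4) (p : Bool × Bool) : F4 :=
  (if p.1 then 1 else 0) + (if p.2 then ω else 0)

/-- Addition of coordinate pairs. -/
def bitsAdd (p q : Bool × Bool) : Bool × Bool := (xor p.1 q.1, xor p.2 q.2)

/-- Multiplication by `ω` on coordinate pairs. -/
def bitsMulOmega (p : Bool × Bool) : Bool × Bool := (p.2, xor p.1 p.2)

/-- Whether a coordinate pair represents a nonzero element. -/
def bitsNonzero (p : Bool × Bool) : Bool := p.1 || p.2

theorem ofBits_add (ω : F4) (p q : Bool × Bool) :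
    ofBits ω p + ofBits ω q = ofBits ω (bitsAdd p q) := by
  have h2 : (2 : F4) = 0 := CharTwo.two_eq_zero
  obtain ⟨a, b⟩ := p
  obtain ⟨c, d⟩ := q
  cases a <;> cases b <;> cases c <;> cases d <;> simp [ofBits, bitsAdd] <;> grind

theorem ofBits_mul_omega {ω : F4} (hω : ω ^ 2 = ω + 1) (p : Bool × Bool) :
    ofBits ω p * ω = ofBits ω (bitsMulOmega p) := by
  have h2 : (2 : F4) = 0 := CharTwo.two_eq_zero
  obtain ⟨a, b⟩ := p
  cases a <;> cases b <;> simp [ofBits, bitsMulOmega] <;> grind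

theorem ofBits_mul_omega_add_one {ω : F4} (hω : ω ^ 2 = ω + 1) (p : Bool × Bool) :
    ofBits ω p * (ω + 1) = ofBits ω (bitsMulOmega (bitsMulOmega p)) := by
  rw [← ofBits_mul_omega hω, ← ofBits_mul_omega hω, mul_assoc, ← pow_two, hω]

theorem omega_ne_zero {ω : F4} (hω : ω ^ 2 = ω + 1) : ω ≠ 0 := by
  rintro rfl
  simp at hω

theorem omega_add_one_ne_zero {ω : F4} (hω : ω ^ 2 = ω + 1) : ω + 1 ≠ 0 :=
  hω ▸ pow_ne_zero 2 (omega_ne_zero hω)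

theorem ofBits_ne_zero_iff {ω : F4} (hω : ω ^ 2 = ω + 1) (p : Bool × Bool) :
    ofBits ω p ≠ 0 ↔ bitsNonzero p = true := by
  have h0 := omega_ne_zero hω
  have h1 := omega_add_one_ne_zero hω
  obtain ⟨a, b⟩ := p
  cases a <;> cases b <;> simp [ofBits, bitsNonzero] <;> grind

theorem ofBits_surjective {ω : F4} (hω : ω ^ 2 = ω + 1) :
    Function.Surjective (ofBits ω) := by
  have hinj : Function.Injective (ofBits ω) := by
    intro p q h
    have hs : ¬ bitsNonzero (bitsAdd p q) = true := by
      rw [← ofBits_ne_zero_iff hω, ← ofBits_add, h, not_not]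
      exact CharTwo.add_self_eq_zero _
    obtain ⟨a, b⟩ := p
    obtain ⟨c, d⟩ := q
    simp only [bitsNonzero, bitsAdd] at hs
    clear h
    cases a <;> cases b <;> cases c <;> cases d <;> simp at hs ⊢
  have : Fintype F4 := Fintype.ofFinite F4
  refine ((Fintype.bijective_iff_injective_and_card _).2 ⟨hinj, ?_⟩).2
  rw [← Nat.card_eq_fintype_card (α := F4), GaloisField.card 2 2 two_ne_zero]
  rfl

/-- The contribution of a single coordinate to the Hamming weight. -/
def symbolWt {α : Type*} [Zero α] (x : α) : ℕ := if x = 0 then 0 else 1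

theorem symbolWt_ofBits {ω : F4} (hω : ω ^ 2 = ω + 1) (p : Bool × Bool) :
    symbolWt (ofBits ω p) = (bitsNonzero p).toNat := by
  have hp := ofBits_ne_zero_iff hω p
  cases h : bitsNonzero p <;> simp_all [symbolWt]

theorem wt_eq_sum {n : ℕ} {α : Type*} [Zero α] (v : Fin n → α) :
    wt v = ∑ i, symbolWt (v i) := by
  rw [wt, Nat.card_eq_fintype_card, Fintype.card_subtype, Finset.card_filter]
  exact Finset.sum_congr rfl fun i _ => ite_not ..

theorem wt_eq_zero_iff {n : ℕ} {α : Type*} [Zero α] {v : Fin n → α} : wt v = 0 ↔ v = 0 := by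
  simp [wt_eq_sum, symbolWt, funext_iff]

/-- The codeword of `D10` whose information symbols are `c`. -/
theorem sum_smul_generators (ω : F4) (c : Fin 6 → F4) :
    ∑ i, c i • (![r1 ω, r3 ω, r5 ω, r7 ω, r9 ω, r11 ω] : Fin 6 → Fin 10 → F4) i =
      ![c 0, c 1, c 2, c 3, c 4, c 5,
        c 0 * ω + c 1 * (ω + 1) + c 2 + c 4 * (ω + 1) + c 5,
        c 1 + c 2 * ω + c 3 + c 4 * (ω + 1) + c 5 * ω,
        c 0 * ω + c 1 + c 2 * (ω + 1) + c 3 * ω + c 5,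
        c 0 * (ω + 1) + c 1 + c 3 * (ω + 1) + c 4 + c 5] := by
  ext j
  fin_cases j <;> simp [Fin.sum_univ_succ, r1, r3, r5, r7, r9, r11] <;> ring

/-- The Hamming weight of the codeword with the given information symbols, computed on
coordinate pairs. -/
def bitsWeight (a b c d e f : Bool × Bool) : ℕ :=
  let w := bitsMulOmega
  let s := bitsAdd
  let t := fun p => (bitsNonzero p).toNat
  t a + t b + t c + t d + t e + t f +
    t (s (s (s (s (w a) (w (w b))) c) (w (w e))) f) +
    t (s (s (s (s b (w c)) d) (w (w e))) (w f)) +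
    t (s (s (s (s (w a) b) (w (w c))) (w d)) f) +
    t (s (s (s (s (w (w a)) b) (w (w d))) e) f)

/-- Conjunction over all coordinate pairs. -/
def allBits (P : Bool × Bool → Bool) : Bool :=
  P (false, false) && P (false, true) && P (true, false) && P (true, true)

theorem allBits_spec {P : Bool × Bool → Bool} (h : allBits P = true) (p : Bool × Bool) :
    P p = true := by
  simp only [allBits, Bool.and_eq_true] at h
  obtain ⟨a, b⟩ := p
  cases a <;> cases b <;> simp [h]

theorem allBits_bitsWeight :
    (allBits fun a => allBits fun b => allBits fun c => allBits fun d => allBits fun e =>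
      allBits fun f => (Nat.beq (bitsWeight a b c d e f) 0) ||
        Nat.ble 4 (bitsWeight a b c d e f)) = true := by
  decide +kernel

theorem bitsWeight_eq_zero_or_four_le (a b c d e f : Bool × Bool) :
    bitsWeight a b c d e f = 0 ∨ 4 ≤ bitsWeight a b c d e f := by
  have h := allBits_spec (allBits_spec (allBits_spec (allBits_spec (allBits_spec
    (allBits_spec allBits_bitsWeight a) b) c) d) e) f
  simpa [Bool.or_eq_true, Nat.beq_eq] using h

theorem wt_sum_smul_generators {ω : F4} (hω : ω ^ 2 = ω + 1) (p : Fin 6 → Bool × Bool) :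
    wt (∑ i, ofBits ω (p i) •
      (![r1 ω, r3 ω, r5 ω, r7 ω, r9 ω, r11 ω] : Fin 6 → Fin 10 → F4) i) =
      bitsWeight (p 0) (p 1) (p 2) (p 3) (p 4) (p 5) := by
  rw [sum_smul_generators ω fun i => ofBits ω (p i), wt_eq_sum]
  simp only [ofBits_mul_omega hω, ofBits_mul_omega_add_one hω, ofBits_add]
  simp [Fin.sum_univ_succ, symbolWt_ofBits hω, bitsWeight, add_assoc]

theorem stmt7 (ω : F4) (hω : ω ^ 2 = ω + 1) :
    Module.finrank F4 (D10 ω) = 6 ∧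
    (∀ v ∈ D10 ω, v ≠ 0 → 4 ≤ wt v) ∧ (∃ v ∈ D10 ω, wt v = 4) := by
  refine ⟨?_, ?_, r1 ω, Submodule.subset_span ⟨0, rfl⟩, ?_⟩
  · rw [D10, finrank_span_eq_card, Fintype.card_fin]
    rw [Fintype.linearIndependent_iff]
    intro c hc i
    rw [sum_smul_generators] at hc
    have h := congrFun hc (Fin.castLE (by norm_num) i)
    fin_cases i <;> exact h
  · intro v hv hv0
    obtain ⟨c, rfl⟩ := (Submodule.mem_span_range_iff_exists_fun F4).1 hv
    choose p hp using fun i => ofBits_surjective hω (c i)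
    obtain rfl : (fun i => ofBits ω (p i)) = c := funext hp
    rw [Ne, ← wt_eq_zero_iff, wt_sum_smul_generators hω] at hv0
    rw [wt_sum_smul_generators hω]
    exact (bitsWeight_eq_zero_or_four_le _ _ _ _ _ _).resolve_left hv0
  · simp [wt_eq_sum, symbolWt, Fin.sum_univ_succ, r1, omega_ne_zero hω, omega_add_one_ne_zero hω]
end
end

section
/- The weight distribution of C_O^40 is: the number of codewords of Hamming weight w equals 1 for w=0, 741 for w=8, 6144 for w=10, 42736 for w=12, 176640 for w=14, 484890 for w=16, 849408 for w=18, 1073184 for w=20, 849408 for w=22, 484890 for w=24, 176640 for w=26, 42736 for w=28, 6144 for w=30, 741 for w=32, 1 for w=40, and 0 for all other w. -/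
open Matrix
open scoped Classical

noncomputable section

/-- φ : GF(4) → GF(2)⁴ with φ(0)=0000, φ(1)=0011, φ(ω)=0101, φ(ω̄)=0110. -/
def phi (ω : F4) (x : F4) : Fin 4 → F2 :=
  if x = 0 then ![0, 0, 0, 0]
  else if x = 1 then ![0, 0, 1, 1]
  else if x = ω then ![0, 1, 0, 1]
  else ![0, 1, 1, 0]

/-- Φ applies φ to each coordinate and concatenates. -/
def Phi (ω : F4) (v : Fin 10 → F4) : Fin 40 → F2 := fun j =>
  phi ω (v ⟨j.val / 4, by have := j.isLt; omega⟩) ⟨j.val % 4, by omega⟩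

/-- u i (for i = 0, …, 8, corresponding to u_(i+1)) has ones exactly in the eight
positions 4(i+1)-3, …, 4(i+1)+4 (1-indexed). -/
def u (i : Fin 9) : Fin 40 → F2 := fun j =>
  if 4 * i.val ≤ j.val ∧ j.val < 4 * i.val + 8 then 1 else 0

/-- (1,0,0,0) repeated 10 times. -/
def d1 : Fin 40 → F2 := fun j => if j.val % 4 = 0 then 1 else 0

/-- (1,0,0,0) repeated 9 times followed by (0,1,1,1). -/
def d2 : Fin 40 → F2 := fun j =>
  if j.val < 36 then (if j.val % 4 = 0 then 1 else 0)
  else (if j.val % 4 = 0 then 0 else 1)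

def gensO40 (ω : F4) : Fin 22 → Fin 40 → F2 :=
  ![Phi ω (r1 ω), Phi ω (r2 ω), Phi ω (r3 ω), Phi ω (r4 ω), Phi ω (r5 ω), Phi ω (r6 ω),
    Phi ω (r7 ω), Phi ω (r8 ω), Phi ω (r9 ω), Phi ω (r10 ω), Phi ω (r11 ω), Phi ω (r12 ω),
    u 0, u 1, u 2, u 3, u 4, u 5, u 6, u 7, u 8, d2]

def CO40 (ω : F4) : Submodule F2 (Fin 40 → F2) :=
  Submodule.span F2 (Set.range (gensO40 ω))

/-- The `i`-th binary digit of `m`, as an element of `F2`. -/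
def bit (m i : ℕ) : F2 := if m.testBit i then 1 else 0

lemma bit_xor (m n i : ℕ) : bit (m ^^^ n) i = bit m i + bit n i := by
  unfold bit
  rw [Nat.testBit_xor]
  cases m.testBit i <;> cases n.testBit i <;> decide

/-- A word of length ten over `F2 × F2` packed into twenty bits: the pair at position `i`
consists of the bits `i` and `i + 10`. -/
def decode (m : ℕ) (i : Fin 10) : F2 × F2 := (bit m i, bit m (i + 10))

lemma decode_xor (m n : ℕ) : decode (m ^^^ n) = decode m + decode n := by
  ext i <;> simp [decode, bit_xor]

/-- The rows `r1, …, r12`, packed, with `(a, b)` standing for `a + b ω`. -/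
def rowList : List ℕ :=
  [852481, 329536, 66498, 919616, 393540, 201088, 787080, 402176, 197328, 540864, 131936, 1015936]

def packedRow (k : Fin 12) : ℕ := rowList[k]

/-- The element `a + b ω` of `F4`. -/
def toF4 (ω : F4) (c : F2 × F2) : F4 :=
  if c = (0, 0) then 0 else if c = (1, 0) then 1 else if c = (0, 1) then ω else ω + 1

/-- The additive map `phi` in the coordinates of `toF4`. -/
def phi₂ (c : F2 × F2) (t : Fin 4) : F2 :=
  c.1 * (![0, 0, 1, 1] : Fin 4 → F2) t + c.2 * (![0, 1, 0, 1] : Fin 4 → F2) t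

lemma phi_toF4 {ω : F4} (hω : ω ^ 2 = ω + 1) (c : F2 × F2) : phi ω (toF4 ω c) = phi₂ c := by
  have h0 : ω ≠ 0 := by rintro rfl; simp at hω
  have h1 : ω ≠ 1 := by rintro rfl; simp at hω
  have h2 : ω + 1 ≠ 0 := fun h => h0 (by simpa [h] using hω)
  obtain ⟨a, b⟩ := c
  have hF : ∀ a : F2, a = 0 ∨ a = 1 := by decide
  rcases hF a with rfl | rfl <;> rcases hF b with rfl | rfl <;> ext t <;> fin_cases t <;>
    simp [phi, toF4, phi₂, h0, h1, h2]
  decide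

/-- The position of the `t`-th coordinate of the `i`-th block. -/
def pos (i : Fin 10) (t : Fin 4) : Fin 40 := finProdFinEquiv (m := 10) (n := 4) (i, t)

lemma pos_div (i : Fin 10) (t : Fin 4) : (pos i t).val / 4 = i := by
  revert i t; decide

lemma pos_mod (i : Fin 10) (t : Fin 4) : (pos i t).val % 4 = t := by
  revert i t; decide

lemma Phi_pos {ω : F4} (hω : ω ^ 2 = ω + 1) {r : Fin 10 → F4} {m : ℕ}
    (hr : ∀ i, r i = toF4 ω (decode m i)) (i : Fin 10) (t : Fin 4) :
    Phi ω r (pos i t) = phi₂ (decode m i) t := by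
  simp only [Phi, pos_div, pos_mod, Fin.eta, hr, phi_toF4 hω]

/-- The rows `r1, …, r12`. -/
def rowF4 (ω : F4) : Fin 12 → Fin 10 → F4 :=
  ![r1 ω, r2 ω, r3 ω, r4 ω, r5 ω, r6 ω, r7 ω, r8 ω, r9 ω, r10 ω, r11 ω, r12 ω]

lemma rowF4_eq (ω : F4) (k : Fin 12) (i : Fin 10) :
    rowF4 ω k i = toF4 ω (decode (packedRow k) i) := by
  fin_cases k <;> fin_cases i <;>
    simp [rowF4, r1, r2, r3, r4, r5, r6, r7, r8, r9, r10, r11, r12, packedRow, rowList, decode, bit,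
      toF4, Nat.testBit]

/-- The map sending coefficients to the corresponding combination of generators. -/
def encode (ω : F4) : (Fin 12 → F2) × (Fin 9 → F2) × F2 →ₗ[F2] (Fin 40 → F2) :=
  (Fintype.linearCombination F2 fun k => Phi ω (rowF4 ω k)).coprod
    ((Fintype.linearCombination F2 u).coprod (LinearMap.toSpanSingleton F2 _ d2))

lemma range_encode (ω : F4) : LinearMap.range (encode ω) = CO40 ω := by
  rw [encode, LinearMap.range_coprod, LinearMap.range_coprod, Fintype.range_linearCombination,
    Fintype.range_linearCombination, LinearMap.range_toSpanSingleton, ← Submodule.span_union,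
    ← Submodule.span_union, CO40]
  congr 1
  apply Set.Subset.antisymm
  · rintro v (⟨k, rfl⟩ | ⟨k, rfl⟩ | rfl)
    · exact ⟨⟨k, by omega⟩, by fin_cases k <;> rfl⟩
    · exact ⟨⟨k + 12, by omega⟩, by fin_cases k <;> rfl⟩
    · exact ⟨21, rfl⟩
  · rintro v ⟨k, rfl⟩
    by_cases h : k.val < 12
    · exact Or.inl ⟨⟨k, h⟩, by fin_cases k <;> first | rfl | exact absurd h (by decide)⟩
    by_cases h' : k.val < 21
    · exact Or.inr (Or.inl ⟨⟨k - 12, by omega⟩, by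
        fin_cases k <;> first | rfl | exact absurd (by decide) h | exact absurd h' (by decide)⟩)
    · right; right
      have : k = 21 := by ext; simp; omega
      subst this; rfl

/-- The word of length ten over `F2 × F2` with coefficient vector `x`. -/
def base (x : Fin 12 → F2) : Fin 10 → F2 × F2 := ∑ k, x k • decode (packedRow k)

/-- The blocks that get complemented by `∑ j, y j • u j`. -/
def blockFlip (y : Fin 9 → F2) : Fin 10 → F2 :=
  ![y 0, y 0 + y 1, y 1 + y 2, y 2 + y 3, y 3 + y 4, y 4 + y 5, y 5 + y 6, y 6 + y 7, y 7 + y 8,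
    y 8]

/-- A block of four coordinates of a codeword. -/
def block (c : F2 × F2) (e d : F2) (i : Fin 10) (t : Fin 4) : F2 :=
  phi₂ c t + e + d * ((if t = 0 then 1 else 0) + if i = 9 then 1 else 0)

lemma u_pos (j : Fin 9) (i : Fin 10) (t : Fin 4) :
    u j (pos i t) = if i.val = j ∨ i.val = j + 1 then 1 else 0 := by
  revert j i t; decide +kernel

lemma d2_pos (i : Fin 10) (t : Fin 4) :
    d2 (pos i t) = (if t = 0 then 1 else 0) + if i = 9 then 1 else 0 := by
  revert i t; decide +kernel

lemma encode_pos {ω : F4} (hω : ω ^ 2 = ω + 1) (x : Fin 12 → F2) (y : Fin 9 → F2) (d : F2)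
    (i : Fin 10) (t : Fin 4) :
    encode ω (x, y, d) (pos i t) = block (base x i) (blockFlip y i) d i t := by
  have hx : (∑ k, x k • Phi ω (rowF4 ω k)) (pos i t) = phi₂ (base x i) t := by
    simp only [Finset.sum_apply, Pi.smul_apply, Phi_pos hω (rowF4_eq ω _), phi₂, base,
      Prod.fst_sum, Prod.snd_sum, Prod.smul_fst, Prod.smul_snd, Finset.sum_mul, smul_eq_mul,
      mul_add, Finset.sum_add_distrib, mul_assoc]
  have hy : (∑ j, y j • u j) (pos i t) = blockFlip y i := by
    simp only [Finset.sum_apply, Pi.smul_apply, u_pos, smul_eq_mul]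
    fin_cases i <;> simp [Fin.sum_univ_succ, blockFlip]
  simp only [encode, LinearMap.coprod_apply, Fintype.linearCombination_apply,
    LinearMap.toSpanSingleton_apply, Pi.add_apply, hx, hy, Pi.smul_apply, d2_pos, block,
    smul_eq_mul, add_assoc]

/-- The weight of a block. -/
def blockWt (c : F2 × F2) (e d : F2) (i : Fin 10) : ℕ :=
  ∑ t, if block c e d i t ≠ 0 then 1 else 0

lemma wt_encode {ω : F4} (hω : ω ^ 2 = ω + 1) (x : Fin 12 → F2) (y : Fin 9 → F2) (d : F2) :
    wt (encode ω (x, y, d)) = ∑ i, blockWt (base x i) (blockFlip y i) d i := by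
  rw [wt, Nat.card_eq_fintype_card, Fintype.card_subtype, Finset.card_filter,
    ← Equiv.sum_comp (finProdFinEquiv (m := 10) (n := 4)), Fintype.sum_prod_type]
  refine Finset.sum_congr rfl fun i _ => Finset.sum_congr rfl fun t _ => ?_
  rw [← encode_pos hω]
  rfl

/-- The nontrivial additive character of `F2`. -/
def sgn (R : Type*) [Ring R] (a : F2) : R := if a = 0 then 1 else -1

lemma prod_sgn {R ι : Type*} [CommRing R] (s : Finset ι) (e : ι → F2) :
    ∏ i ∈ s, sgn R (e i) = sgn R (∑ i ∈ s, e i) := by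
  have hmul : ∀ a b : F2, sgn R (a + b) = sgn R a * sgn R b := by
    have h2 : (1 : F2) + 1 = 0 := by decide
    have hF : ∀ a : F2, a = 0 ∨ a = 1 := by decide
    intro a b
    rcases hF a with rfl | rfl <;> rcases hF b with rfl | rfl <;> simp [sgn, h2]
  induction s using Finset.cons_induction with
  | empty => simp [sgn]
  | cons a s ha ih => rw [Finset.prod_cons, Finset.sum_cons, hmul, ih]

lemma sum_blockFlip {M : Type*} [AddCommMonoid M] (g : (Fin 10 → F2) → M) :
    ∑ y, g (blockFlip y) = ∑ e with ∑ i, e i = 0, g e := by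
  have h2 : ∀ a : F2, a + a = 0 := by decide
  have h2' : ∀ a b : F2, a + (a + b) = b := by decide
  refine Finset.sum_nbij' blockFlip (fun e j => ∑ i ∈ Finset.univ.filter (· ≤ j.castSucc), e i)
    ?_ ?_ ?_ ?_ ?_
  · intro y _
    simp [blockFlip, Fin.sum_univ_succ, add_assoc, h2]
  · simp
  · intro y _
    ext j
    fin_cases j <;>
      simp [blockFlip, Finset.sum_filter, Fin.sum_univ_succ, Fin.le_def, add_assoc, h2']
  · intro e he
    replace he : ∑ i, e i = 0 := by simpa using he
    have hz : ∀ a : F2, (2 : ℤ) • a = 0 := by decide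
    have hneg : ∀ a b : F2, a + b = 0 → a = b := by decide
    ext j
    fin_cases j <;>
      simp [blockFlip, Finset.sum_filter, Fin.sum_univ_succ, Fin.le_def, add_assoc, h2'] at he ⊢
    on_goal -1 => exact hneg _ _ (by simpa only [add_assoc] using he)
    all_goals
      clear he
      abel_nf
      simp only [hz, zero_add]
  · simp

lemma two_mul_sum_prod_blockFlip {R : Type*} [CommRing R] (h : Fin 10 → F2 → R) :
    2 * ∑ y, ∏ i, h i (blockFlip y i) = ∏ i, (h i 0 + h i 1) + ∏ i, (h i 0 - h i 1) := by
  have h0 (i) : h i 0 + h i 1 = ∑ a, h i a := (Fin.sum_univ_two _).symm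
  have h1 (i) : h i 0 - h i 1 = ∑ a, sgn R a * h i a := by
    refine Eq.trans ?_ (Fin.sum_univ_two _).symm
    change _ = sgn R 0 * h i 0 + sgn R 1 * h i 1
    simp [sgn, sub_eq_add_neg]
  simp only [h0, h1, Finset.prod_univ_sum, Fintype.piFinset_univ, Finset.prod_mul_distrib,
    prod_sgn, ← Finset.sum_add_distrib]
  rw [sum_blockFlip fun e => ∏ i, h i (e i), Finset.sum_filter, Finset.mul_sum]
  refine Finset.sum_congr rfl fun e _ => ?_
  split_ifs with he <;> simp [sgn, he, two_mul]

/-- The number of nonzero entries of a word over `F2 × F2`. -/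
def numNonzero (c : Fin 10 → F2 × F2) : ℕ := ∑ i, if c i = 0 then 0 else 1

open Polynomial in
/-- Twice the weight enumerator of the part of the code lying over a word with `k` nonzero
entries. -/
def enumerator (k : ℕ) : ℤ[X] :=
  (1 + X ^ 4) ^ (10 - k) * (2 * X ^ 2) ^ k + (1 - X ^ 4) ^ (10 - k) * 0 ^ k
    + (X + X ^ 3) ^ 10 - (-1) ^ k * (X - X ^ 3) ^ 10

lemma prod_ite_eq_pow {R : Type*} [CommRing R] (c : Fin 10 → F2 × F2) (a b : R) :
    ∏ i, (if c i = 0 then a else b) = a ^ (10 - numNonzero c) * b ^ numNonzero c := by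
  have hb : numNonzero c = (Finset.univ.filter fun i => ¬ c i = 0).card := by
    simp [numNonzero, Finset.card_filter]
  have ha : 10 - numNonzero c = (Finset.univ.filter fun i => c i = 0).card := by
    have := Finset.card_filter_add_card_filter_not (s := Finset.univ) (fun i => c i = 0)
    simp only [Finset.card_univ, Fintype.card_fin] at this
    omega
  rw [Finset.prod_ite, Finset.prod_const, Finset.prod_const, ← ha, ← hb]

open Polynomial in
lemma two_mul_sum_pow_blockWt (c : Fin 10 → F2 × F2) :
    2 * ∑ y, ∑ d, (X : ℤ[X]) ^ (∑ i, blockWt (c i) (blockFlip y i) d i) =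
      enumerator (numNonzero c) := by
  have w0 : ∀ (c : F2 × F2) i, blockWt c 0 0 i = if c = 0 then 0 else 2 := by decide +kernel
  have w1 : ∀ (c : F2 × F2) i, blockWt c 1 0 i = if c = 0 then 4 else 2 := by decide +kernel
  have w2 : ∀ (c : F2 × F2) i, blockWt c 0 1 i = if (c = 0 ↔ i ≠ 9) then 1 else 3 := by
    decide +kernel
  have w3 : ∀ (c : F2 × F2) i, blockWt c 1 1 i = if (c = 0 ↔ i ≠ 9) then 3 else 1 := by
    decide +kernel
  have hs : ∀ f : F2 → ℤ[X], ∑ d, f d = f 0 + f 1 := fun f => Fin.sum_univ_two _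
  simp only [hs, Finset.sum_add_distrib, mul_add, ← Finset.prod_pow_eq_pow_sum]
  rw [two_mul_sum_prod_blockFlip fun i e => (X : ℤ[X]) ^ blockWt (c i) e 0 i,
    two_mul_sum_prod_blockFlip fun i e => (X : ℤ[X]) ^ blockWt (c i) e 1 i]
  simp only [w0, w1, w2, w3]
  have e0 (i) : (X : ℤ[X]) ^ (if c i = 0 then 0 else 2) + X ^ (if c i = 0 then 4 else 2) =
      if c i = 0 then 1 + X ^ 4 else 2 * X ^ 2 := by split_ifs <;> ring
  have e1 (i) : (X : ℤ[X]) ^ (if c i = 0 then 0 else 2) - X ^ (if c i = 0 then 4 else 2) =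
      if c i = 0 then 1 - X ^ 4 else 0 := by split_ifs <;> ring
  have e2 (i) : (X : ℤ[X]) ^ (if c i = 0 ↔ i ≠ 9 then 1 else 3) +
      X ^ (if c i = 0 ↔ i ≠ 9 then 3 else 1) = X + X ^ 3 := by split_ifs <;> ring
  have e3 (i) : (X : ℤ[X]) ^ (if c i = 0 ↔ i ≠ 9 then 1 else 3) -
      X ^ (if c i = 0 ↔ i ≠ 9 then 3 else 1) =
        (if c i = 0 then 1 else -1) * ((if i = 9 then -1 else 1) * (X - X ^ 3)) := by
    split_ifs <;> first | ring1 | (exfalso; tauto)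
  simp only [e0, e1, e2, e3, Finset.prod_mul_distrib, prod_ite_eq_pow, Finset.prod_const,
    Finset.card_univ, Fintype.card_fin, Finset.prod_ite_eq', Finset.mem_univ, if_true, enumerator]
  ring

/-- The sum of `f` over all words obtained by adding a subset of `gs` to `m`. -/
def subsetSum (f : ℕ → ℕ) : List ℕ → ℕ → ℕ
  | [], m => f m
  | g :: gs, m => subsetSum f gs m + subsetSum f gs (m ^^^ g)

lemma sum_decode (F : (Fin 10 → F2 × F2) → ℕ) (gs : List ℕ) (m : ℕ) :
    ∑ x : Fin gs.length → F2, F (decode m + ∑ k, x k • decode gs[k]) =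
      subsetSum (fun m => F (decode m)) gs m := by
  induction gs generalizing m with
  | nil => simp [subsetSum]
  | cons g gs ih =>
    rw [subsetSum, ← ih, ← ih]
    refine ((Fin.consEquiv fun _ : Fin (gs.length + 1) => F2).sum_comp _).symm.trans ?_
    rw [Fintype.sum_prod_type]
    refine (Fin.sum_univ_two _).trans ?_
    congr 1 <;> refine Finset.sum_congr rfl fun x _ => congrArg F ?_
    · refine congrArg _ ((Fin.sum_univ_succ _).trans ?_)
      change (0 : F2) • decode g + ∑ i, x i • decode gs[i] = _
      rw [zero_smul, zero_add]
    · rw [decode_xor, add_assoc]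
      refine congrArg _ ((Fin.sum_univ_succ _).trans ?_)
      change (1 : F2) • decode g + ∑ i, x i • decode gs[i] = _
      rw [one_smul]

/-- The number of nonzero entries of the word packed in `m`. -/
def packedWt (m : ℕ) : ℕ := ∑ i : Fin 10, (m ||| m >>> 10) / 2 ^ i.val % 2

lemma numNonzero_decode (m : ℕ) : numNonzero (decode m) = packedWt m := by
  refine Finset.sum_congr rfl fun i _ => ?_
  rw [← Nat.toNat_testBit, Nat.testBit_or, Nat.testBit_shiftRight, add_comm 10]
  unfold decode bit
  cases m.testBit i <;> cases m.testBit (i + 10) <;> simp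

/-- The weight distribution of the code spanned by `r1, …, r12`. -/
def baseCount : ℕ → ℕ
  | 0 => 1 | 4 => 87 | 5 => 258 | 6 => 555 | 7 => 1020 | 8 => 1200 | 9 => 738 | 10 => 237 | _ => 0

lemma card_base (k : ℕ) (hk : k < 11) :
    (Finset.univ.filter fun x => numNonzero (base x) = k).card = baseCount k := by
  have hcount : ∀ k < 11,
      subsetSum (fun m => if packedWt m = k then 1 else 0) rowList 0 = baseCount k := by
    decide +kernel
  have hd : decode 0 = 0 := by ext i <;> simp [decode, bit]
  have := sum_decode (fun c => if numNonzero c = k then 1 else 0) rowList 0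
  simp only [numNonzero_decode, hcount k hk, hd, zero_add] at this
  rw [Finset.card_filter]
  exact this

/-- The claimed weight distribution. -/
def distribution (w : ℕ) : ℕ :=
  if w = 0 then 1 else if w = 8 then 741 else if w = 10 then 6144 else if w = 12 then 42736 else if w = 14 then 176640 else if w = 16 then 484890 else if w = 18 then 849408 else if w = 20 then 1073184 else if w = 22 then 849408 else if w = 24 then 484890 else if w = 26 then 176640 else if w = 28 then 42736 else if w = 30 then 6144 else if w = 32 then 741 else if w = 40 then 1 else 0

open Polynomial in
lemma sum_baseCount_smul_enumerator :
    ∑ k ∈ Finset.range 11, baseCount k • enumerator k =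
      2 * ∑ w ∈ Finset.range 41, C (distribution w : ℤ) * X ^ w := by
  simp only [Finset.sum_range_succ, Finset.sum_range_zero, baseCount, distribution, enumerator]
  norm_num
  ring

lemma numNonzero_lt (c : Fin 10 → F2 × F2) : numNonzero c < 11 := by
  have : numNonzero c ≤ ∑ _i : Fin 10, 1 := Finset.sum_le_sum fun i _ => by split_ifs <;> simp
  simpa [Nat.lt_succ_iff] using this

lemma sum_comp_eq_sum_card_smul {ι M : Type*} [Fintype ι] [AddCommMonoid M] {n : ℕ} {g : ι → ℕ}
    (hg : ∀ x, g x < n) (F : ℕ → M) :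
    ∑ x, F (g x) = ∑ k ∈ Finset.range n, (Finset.univ.filter fun x => g x = k).card • F k := by
  rw [← Finset.sum_fiberwise_of_maps_to (t := Finset.range n) (g := g)
    fun x _ => Finset.mem_range.2 (hg x)]
  refine Finset.sum_congr rfl fun k _ => ?_
  rw [← Finset.sum_const]
  exact Finset.sum_congr rfl fun x hx => by rw [(Finset.mem_filter.1 hx).2]

open Polynomial in
lemma sum_pow_eq_of_fibers {α β γ : Type*} [Fintype α] [Fintype β] [Fintype γ] {f : α × β × γ → ℕ}
    {g : α → ℕ} {E : ℕ → ℤ[X]} {b : ℕ → ℕ} {n : ℕ} {P : ℤ[X]} (hg : ∀ x, g x < n)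
    (hfg : ∀ x, 2 * ∑ y, ∑ z, (X : ℤ[X]) ^ f (x, y, z) = E (g x))
    (hb : ∀ k < n, (Finset.univ.filter fun x => g x = k).card = b k)
    (hP : ∑ k ∈ Finset.range n, b k • E k = 2 * P) :
    ∑ p, (X : ℤ[X]) ^ f p = P := by
  refine mul_left_cancel₀ (two_ne_zero : (2 : ℤ[X]) ≠ 0) ?_
  rw [← hP, Fintype.sum_prod_type, Finset.mul_sum]
  simp only [Fintype.sum_prod_type, hfg]
  rw [sum_comp_eq_sum_card_smul hg]
  exact Finset.sum_congr rfl fun k hk => by rw [hb k (Finset.mem_range.1 hk)]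

open Polynomial in
lemma sum_pow_wt_encode {ω : F4} (hω : ω ^ 2 = ω + 1) :
    ∑ p, (X : ℤ[X]) ^ wt (encode ω p) =
      ∑ w ∈ Finset.range 41, C (distribution w : ℤ) * X ^ w := by
  refine sum_pow_eq_of_fibers (f := fun p => wt (encode ω p)) (g := fun x => numNonzero (base x))
    (E := enumerator) (b := baseCount) (n := 11) (fun x => numNonzero_lt _) (fun x => ?_)
    card_base sum_baseCount_smul_enumerator
  rw [← two_mul_sum_pow_blockWt]
  simp only [wt_encode hω]

open Polynomial in
lemma card_eq_of_sum_pow_eq {ι : Type*} [Fintype ι] {n : ℕ} {a : ℕ → ℕ} {f : ι → ℕ}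
    (h : ∑ p, (X : ℤ[X]) ^ f p = ∑ w ∈ Finset.range n, C (a w : ℤ) * X ^ w)
    (ha : ∀ w, n ≤ w → a w = 0) (w : ℕ) :
    (Finset.univ.filter fun p => f p = w).card = a w := by
  have h := congrArg (fun P => P.coeff w) h
  simp only [finsetSum_coeff, coeff_X_pow, coeff_C_mul, mul_ite, mul_one, mul_zero,
    Finset.sum_boole, @eq_comm _ w] at h
  rw [Finset.sum_ite_eq'] at h
  split_ifs at h with hw
  · exact_mod_cast h
  · rw [ha w (by simpa using hw)]
    exact_mod_cast h

lemma card_wt_encode {ω : F4} (hω : ω ^ 2 = ω + 1) (w : ℕ) :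
    (Finset.univ.filter fun p => wt (encode ω p) = w).card = distribution w := by
  refine card_eq_of_sum_pow_eq (sum_pow_wt_encode hω) (fun w hw => ?_) w
  unfold distribution
  repeat rw [if_neg (by omega)]

lemma injective_of_card_wt_eq_zero {V : Type*} [AddCommGroup V] [Module F2 V] [Fintype V] {n : ℕ}
    {f : V →ₗ[F2] (Fin n → F2)} (h : (Finset.univ.filter fun p => wt (f p) = 0).card = 1) :
    Function.Injective f := by
  have h0 : wt (0 : Fin n → F2) = 0 := by simp [wt]
  refine (injective_iff_map_eq_zero f).2 fun p hp => Finset.card_le_one.1 h.le p ?_ 0 ?_ <;>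
    simp [*]

lemma ncard_range_wt {V : Type*} [AddCommGroup V] [Module F2 V] [Fintype V] {n : ℕ}
    {f : V →ₗ[F2] (Fin n → F2)} (hf : Function.Injective f) (w : ℕ) :
    Set.ncard {v | v ∈ LinearMap.range f ∧ wt v = w} =
      (Finset.univ.filter fun p => wt (f p) = w).card := by
  rw [← Set.ncard_coe_finset, ← Set.ncard_image_of_injective _ hf]
  congr 1
  ext v
  constructor
  · rintro ⟨⟨p, rfl⟩, hp⟩
    exact ⟨p, by simpa using hp, rfl⟩
  · rintro ⟨p, hp, rfl⟩
    exact ⟨⟨p, rfl⟩, by simpa using hp⟩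

theorem stmt16 (ω : F4) (hω : ω ^ 2 = ω + 1) (w : ℕ) :
    Set.ncard {v | v ∈ CO40 ω ∧ wt v = w} =
      if w = 0 then 1 else if w = 8 then 741 else if w = 10 then 6144 else if w = 12 then 42736 else if w = 14 then 176640 else if w = 16 then 484890 else if w = 18 then 849408 else if w = 20 then 1073184 else if w = 22 then 849408 else if w = 24 then 484890 else if w = 26 then 176640 else if w = 28 then 42736 else if w = 30 then 6144 else if w = 32 then 741 else if w = 40 then 1 else 0 := by
  have hinj : Function.Injective (encode ω) := injective_of_card_wt_eq_zero (card_wt_encode hω 0)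
  rw [← range_encode, ncard_range_wt hinj, card_wt_encode hω, distribution]
end
end
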